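/- In the digraph H_k (k ≥ 3), the distances satisfy d(v_1,u_1) = k−1, d(u_1,w_1) = k−1 and d(w_1,v_1) = k−1. -/

import Mathlib

open List

attribute [local instance] Classical.propDecidable

variable {V : Type*}

/-- `l` is the vertex list of a directed path from `u` to `v` in the digraph with arc
relation `A`: the vertices are pairwise distinct, consecutive vertices are joined by
arcs, the path starts at `u` and ends at `v`.  Its length (number of arcs) is
`l.length - 1`. -/
def IsPath (A : V → V → Prop) (u v : V) (l : List V) : Prop :=
  l.Nodup ∧ l.Chain' A ∧ l.head? = some u ∧ l.getLast? = some v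

/-- The arcs of a directed path given by its vertex list. -/
def pathArcs (l : List V) : List (V × V) := l.zip l.tail

/-- The distance from `u` to `v` in the digraph with arc relation `A`: the least number
of arcs on a directed `uv`-path, and `⊤` if there is no such path. -/
noncomputable def ddist (A : V → V → Prop) (u v : V) : ℕ∞ :=
  sInf {n : ℕ∞ | ∃ l : List V, IsPath A u v l ∧ (l.length : ℕ∞) = n + 1}

/-- The arcs of the directed cycle whose vertex list is `l` (consecutive pairs,
including the wrap-around arc from the last vertex to the first). -/
def cycleArcs (l : List V) : List (V × V) := l.zip (l.rotate 1)

/-- `l` is the vertex list of a directed cycle of the digraph with arc relation `A`;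
the length `‖l‖` of the cycle is `l.length`. -/
def IsCycle (A : V → V → Prop) (l : List V) : Prop :=
  2 ≤ l.length ∧ l.Nodup ∧ ∀ p ∈ cycleArcs l, A p.1 p.2

/-- The number of symmetric arcs of the cycle with vertex list `l`. -/
noncomputable def symCount (A : V → V → Prop) (l : List V) : ℕ :=
  (cycleArcs l).countP (fun p => decide (A p.2 p.1))

/-- The `m`-closure of a digraph: there is an arc from `u` to `v` iff `u ≠ v` and the
distance from `u` to `v` in `D` is at most `m`. -/
def mClosure (A : V → V → Prop) (m : ℕ) : V → V → Prop :=
  fun u v => u ≠ v ∧ ddist A u v ≤ (m : ℕ∞)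

/-- A set `S` is `k`-independent if the distance between any two distinct vertices of
`S` is at least `k`. -/
def KIndependent (A : V → V → Prop) (k : ℕ) (S : Set V) : Prop :=
  ∀ u ∈ S, ∀ v ∈ S, u ≠ v → (k : ℕ∞) ≤ ddist A u v

/-- A set `S` is `ℓ`-absorbent if every vertex outside `S` is at distance at most `ℓ`
from some vertex of `S`. -/
def LAbsorbent (A : V → V → Prop) (ℓ : ℕ) (S : Set V) : Prop :=
  ∀ u, u ∉ S → ∃ v ∈ S, ddist A u v ≤ (ℓ : ℕ∞)

/-- A `k`-kernel is a `k`-independent and `(k-1)`-absorbent set. -/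
def IsKKernel (A : V → V → Prop) (k : ℕ) (S : Set V) : Prop :=
  KIndependent A k S ∧ LAbsorbent A (k - 1) S

/-- A kernel is a `2`-kernel, i.e. an independent set that `1`-absorbs every vertex
outside of it. -/
def IsKernel (A : V → V → Prop) (S : Set V) : Prop := IsKKernel A 2 S

/-- A digraph is kernel-perfect if every induced subdigraph has a kernel. -/
def KernelPerfect (A : V → V → Prop) : Prop :=
  ∀ S : Set V, ∃ K : Set S, IsKernel (fun x y : S => A x.1 y.1) K
/-- The vertex set of the digraph `H_k`: three copies `v`, `u`, `w` of `{1, …, k-1}`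
(indexed here by `Fin (k-1)`, with `i : Fin (k-1)` standing for the vertex with
subscript `i+1`), together with the six extra vertices `e_v, f_v, e_u, f_u, e_w, f_w`. -/
inductive HkV (k : ℕ) : Type
  | vv (i : Fin (k - 1)) : HkV k
  | uu (i : Fin (k - 1)) : HkV k
  | ww (i : Fin (k - 1)) : HkV k
  | ev : HkV k
  | fv : HkV k
  | eu : HkV k
  | fu : HkV k
  | ew : HkV k
  | fw : HkV k

/-- The arc relation of the digraph `H_k`: the symmetric arcs between consecutive
vertices of each of the three paths, the arcs `(v_{k-1}, u_1)`, `(u_{k-1}, w_1)`,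
`(w_{k-1}, v_1)`, and the pendant arcs `(s_{k-1}, e_s)`, `(e_s, f_s)` for
`s ∈ {v, u, w}`. -/
def HkAdj (k : ℕ) : HkV k → HkV k → Prop
  | .vv i, .vv j => j.val = i.val + 1 ∨ i.val = j.val + 1
  | .uu i, .uu j => j.val = i.val + 1 ∨ i.val = j.val + 1
  | .ww i, .ww j => j.val = i.val + 1 ∨ i.val = j.val + 1
  | .vv i, .uu j => i.val = k - 2 ∧ j.val = 0
  | .uu i, .ww j => i.val = k - 2 ∧ j.val = 0
  | .ww i, .vv j => i.val = k - 2 ∧ j.val = 0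
  | .vv i, .ev => i.val = k - 2
  | .uu i, .eu => i.val = k - 2
  | .ww i, .ew => i.val = k - 2
  | .ev, .fv => True
  | .eu, .fu => True
  | .ew, .fw => True
  | _, _ => False

theorem chain_potential_aux {V : Type*} (A : V → V → Prop) (p : V → ℕ)
    (hp : ∀ x y, A x y → p x ≤ p y + 1) (t : V) (ht : p t = 0) :
    ∀ (l : List V) (a : V), List.IsChain A (a :: l) → (a :: l).getLast? = some t →
      p a ≤ l.length := by
  intro l
  induction l with
  | nil => intro a _ h; simp at h; subst h; simp [ht]
  | cons b l ih =>
    intro a hc h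
    rw [List.isChain_cons_cons] at hc
    have h1 := ih b hc.2 (by simpa [List.getLast?_cons_cons] using h)
    have h2 := hp a b hc.1
    simp only [List.length_cons]
    omega

theorem ddist_eq_aux {V : Type*} (A : V → V → Prop) (n : ℕ) (hn : 0 < n)
    (f : Fin n → V) (t : V) (hinj : Function.Injective f) (hft : ∀ i, f i ≠ t)
    (hstep : ∀ i j : Fin n, j.val = i.val + 1 → A (f i) (f j))
    (hlast : ∀ i : Fin n, i.val + 1 = n → A (f i) t)
    (p : V → ℕ) (hp : ∀ x y, A x y → p x ≤ p y + 1) (ht : p t = 0)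
    (hs : p (f ⟨0, hn⟩) = n) : ddist A (f ⟨0, hn⟩) t = (n : ℕ∞) := by
  apply le_antisymm
  · apply sInf_le
    refine ⟨List.ofFn f ++ [t], ⟨?_, ?_, ?_, ?_⟩, ?_⟩
    · rw [List.nodup_append]
      refine ⟨List.nodup_ofFn.2 hinj, by simp, ?_⟩
      intro a ha b hb
      simp only [List.mem_ofFn, List.mem_singleton] at ha hb
      obtain ⟨i, rfl⟩ := ha
      subst hb
      exact hft i
    · show List.IsChain A _
      rw [List.isChain_iff_getElem]
      intro i hi
      simp only [List.length_append, List.length_ofFn, List.length_singleton] at hi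
      rw [List.getElem_append_left (by simp; omega)]
      by_cases h : i + 1 < n
      · rw [List.getElem_append_left (by simpa using h)]
        simp only [List.getElem_ofFn]
        exact hstep _ _ rfl
      · rw [List.getElem_append_right (by simp; omega)]
        simp only [List.getElem_ofFn, List.getElem_singleton]
        exact hlast _ (by simp; omega)
    · obtain ⟨m, rfl⟩ : ∃ m, n = m + 1 := ⟨n - 1, by omega⟩
      simp [List.ofFn_succ]
    · simp
    · simp
  · apply le_sInf
    rintro m ⟨l, ⟨-, hc, hh, hl⟩, hlen⟩
    cases l with
    | nil => simp at hh
    | cons a l =>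
      simp only [List.head?_cons, Option.some.injEq] at hh
      have h1 := chain_potential_aux A p hp t ht l a hc hl
      rw [hh, hs] at h1
      induction m using ENat.recTopCoe with
      | top => simp
      | coe m =>
        simp only [List.length_cons] at hlen
        norm_cast at hlen ⊢
        omega

/-- In the digraph `H_k` (`k ≥ 3`) one has
`d(v_1, u_1) = k-1`, `d(u_1, w_1) = k-1` and `d(w_1, v_1) = k-1`. -/
theorem Hk_distances (k : ℕ) (hk : 3 ≤ k) :
    ddist (HkAdj k) (HkV.vv ⟨0, by omega⟩) (HkV.uu ⟨0, by omega⟩) = ((k - 1 : ℕ) : ℕ∞) ∧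
    ddist (HkAdj k) (HkV.uu ⟨0, by omega⟩) (HkV.ww ⟨0, by omega⟩) = ((k - 1 : ℕ) : ℕ∞) ∧
    ddist (HkAdj k) (HkV.ww ⟨0, by omega⟩) (HkV.vv ⟨0, by omega⟩) = ((k - 1 : ℕ) : ℕ∞) := by
  refine ⟨?_, ?_, ?_⟩
  · refine ddist_eq_aux (HkAdj k) (k - 1) (by omega) HkV.vv _ (fun a b h => by simpa using h)
      (by simp) (fun i j h => by simp [HkAdj, h]) (fun i h => by simp [HkAdj]; omega)
      (fun x => match x with | .vv i => k - 1 - i.val | _ => 0) ?_ rfl rfl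
    intro x y h
    cases x <;> cases y <;> simp only [HkAdj] at h ⊢ <;> omega
  · refine ddist_eq_aux (HkAdj k) (k - 1) (by omega) HkV.uu _ (fun a b h => by simpa using h)
      (by simp) (fun i j h => by simp [HkAdj, h]) (fun i h => by simp [HkAdj]; omega)
      (fun x => match x with | .uu i => k - 1 - i.val | _ => 0) ?_ rfl rfl
    intro x y h
    cases x <;> cases y <;> simp only [HkAdj] at h ⊢ <;> omega
  · refine ddist_eq_aux (HkAdj k) (k - 1) (by omega) HkV.ww _ (fun a b h => by simpa using h)
      (by simp) (fun i j h => by simp [HkAdj, h]) (fun i h => by simp [HkAdj]; omega)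
      (fun x => match x with | .ww i => k - 1 - i.val | _ => 0) ?_ rfl rfl
    intro x y h
    cases x <;> cases y <;> simp only [HkAdj] at h ⊢ <;> omega
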